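/- arXiv:1611.04903 — 2 statements merged into one kernel-verified Lean document; each statement's English description precedes it below -/
import Mathlib

section
/- Let A, B be integers with A ≥ 3, B ≥ 5, A ≤ B and 2A < B + 3, let M be the 2×2 real matrix with rows (0, −B) and (1, −A), and let T be the unique nonempty compact subset of ℝ² satisfying M·T + ((B−1)/2, 0) = (⋃_{i=0}^{B−2} (T + (i,0))) ∪ (−T). Then for γ in the p2 group Γ with γ ≠ id, one has T ∩ γ(T) ≠ ∅ if and only if γ is one of the following ten isometries: a translation x ↦ x + w with w ∈ {(1,0), (−1,0), (A−1,1), (1−A,−1)}, or a point reflection x ↦ −x + w with w ∈ {(0,0), (1,0), (−1,0), (A−1,1), (1−A,−1), (A,1)}. -/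
open Set Pointwise

noncomputable section

/-- The plane. -/
abbrev Pt : Type := Fin 2 → ℝ

/-- A planar set is disk-like if it is homeomorphic to the closed unit (Euclidean) disk. -/
def DiskLike (S : Set Pt) : Prop :=
  Nonempty (↥S ≃ₜ ↥(Metric.closedBall (0 : EuclideanSpace ℝ (Fin 2)) 1))

/-- The set equation `M T + ((B-1)/2, 0) = (⋃_{i=0}^{B-2} (T + (i,0))) ∪ (-T)`
for `M = !![0, -B; 1, -A]`. -/
def CrysEq (A B : ℤ) (T : Set Pt) : Prop :=
  (fun x => (!![0, -(B:ℝ); 1, -(A:ℝ)]).mulVec x + ![((B:ℝ)-1)/2, 0]) '' T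
    = (⋃ i ∈ Finset.Icc (0:ℤ) (B-2), (fun x => x + ![(i:ℝ), 0]) '' T) ∪ (-T)

/-- The set equation `M L = ⋃_{i=0}^{B-1} (L + (i,0))` for `M = !![0, -B; 1, -A]`. -/
def LatEq (A B : ℤ) (L : Set Pt) : Prop :=
  (fun x => (!![0, -(B:ℝ); 1, -(A:ℝ)]).mulVec x) '' L
    = ⋃ i ∈ Finset.Icc (0:ℤ) (B-1), (fun x => x + ![(i:ℝ), 0]) '' L

/-- Membership in the crystallographic group p2: maps `x ↦ ε x + (p,q)`,
`ε = ±1`, `p q` integers. -/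
def IsP2 (γ : Pt → Pt) : Prop :=
  ∃ (ε : ℝ) (p q : ℤ), (ε = 1 ∨ ε = -1) ∧ γ = fun x => ε • x + ![(p:ℝ), (q:ℝ)]

/-- The image of `T` under `x ↦ ε x + (p, q)` meets `T`. -/
def Meets (T : Set Pt) (ε : ℝ) (p q : ℤ) : Prop :=
  ∃ x ∈ T, ∃ y ∈ T, x 0 = ε * y 0 + p ∧ x 1 = ε * y 1 + q

theorem meets_one_iff (T : Set Pt) (p q : ℤ) :
    (T ∩ (fun x : Pt => x + ![(p:ℝ), (q:ℝ)]) '' T).Nonempty ↔ Meets T 1 p q := by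
  constructor
  · rintro ⟨x, hx, y, hy, rfl⟩
    exact ⟨_, hx, y, hy, by simp, by simp⟩
  · rintro ⟨x, hx, y, hy, h0, h1⟩
    refine ⟨x, hx, y, hy, ?_⟩
    ext i
    fin_cases i <;> simp [h0, h1]

theorem meets_neg_one_iff (T : Set Pt) (p q : ℤ) :
    (T ∩ (fun x : Pt => -x + ![(p:ℝ), (q:ℝ)]) '' T).Nonempty ↔ Meets T (-1) p q := by
  constructor
  · rintro ⟨x, hx, y, hy, rfl⟩
    exact ⟨_, hx, y, hy, by simp, by simp⟩
  · rintro ⟨x, hx, y, hy, h0, h1⟩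
    refine ⟨x, hx, y, hy, ?_⟩
    ext i
    fin_cases i <;> simp [h0, h1]

theorem Meets.one_neg {T : Set Pt} {p q : ℤ} (h : Meets T 1 p q) : Meets T 1 (-p) (-q) := by
  obtain ⟨x, hx, y, hy, h0, h1⟩ := h
  exact ⟨y, hy, x, hx, by push_cast; linarith, by push_cast; linarith⟩

theorem CrysEq.exists_digit {A B : ℤ} {T : Set Pt} (hT : CrysEq A B T) {x : Pt} (hx : x ∈ T) :
    (∃ i : ℤ, 0 ≤ i ∧ i ≤ B - 2 ∧ ∃ y ∈ T,
      -(B:ℝ) * x 1 + ((B:ℝ) - 1) / 2 = y 0 + i ∧ x 0 - A * x 1 = y 1) ∨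
    ∃ y ∈ T, -(B:ℝ) * x 1 + ((B:ℝ) - 1) / 2 = -y 0 ∧ x 0 - A * x 1 = -y 1 := by
  have h := hT.subset (mem_image_of_mem _ hx)
  rcases h with h | h
  · simp only [mem_iUnion] at h
    obtain ⟨i, hi, y, hy, he⟩ := h
    rw [Finset.mem_Icc] at hi
    have h0 := congrFun he 0
    have h1 := congrFun he 1
    simp [dotProduct, Fin.sum_univ_two] at h0 h1
    exact Or.inl ⟨i, hi.1, hi.2, y, hy, by linarith, by linarith⟩
  · refine Or.inr ⟨_, h, ?_, ?_⟩ <;>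
      simp [dotProduct, Fin.sum_univ_two] <;>
      ring

theorem CrysEq.exists_preimage {A B : ℤ} {T : Set Pt} (hT : CrysEq A B T) {y : Pt} (hy : y ∈ T)
    {i : ℤ} (hi0 : 0 ≤ i) (hi : i ≤ B - 2) :
    ∃ x ∈ T, -(B:ℝ) * x 1 + ((B:ℝ) - 1) / 2 = y 0 + i ∧ x 0 - A * x 1 = y 1 := by
  have h : y + ![(i:ℝ), 0] ∈ (⋃ i ∈ Finset.Icc (0:ℤ) (B-2),
      (fun x => x + ![(i:ℝ), 0]) '' T) ∪ (-T) := by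
    left
    simp only [mem_iUnion]
    exact ⟨i, Finset.mem_Icc.2 ⟨hi0, hi⟩, y, hy, rfl⟩
  rw [← hT] at h
  obtain ⟨x, hx, he⟩ := h
  have h0 := congrFun he 0
  have h1 := congrFun he 1
  simp [dotProduct, Fin.sum_univ_two] at h0 h1
  exact ⟨x, hx, by linarith, by linarith⟩

/-- The possible successors of a translation in the neighbor graph. -/
theorem Meets.one_step {A B : ℤ} {T : Set Pt} (hT : CrysEq A B T) {p q : ℤ}
    (h : Meets T 1 p q) : ∃ d : ℤ,
      (|d| ≤ B - 2 ∧ Meets T 1 (-B * q + d) (p - A * q)) ∨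
      (0 ≤ d ∧ d ≤ B - 2 ∧ Meets T (-1) (-B * q - d) (p - A * q)) ∨
      (0 ≤ d ∧ d ≤ B - 2 ∧ Meets T (-1) (B * q - d) (A * q - p)) ∨
      Meets T 1 (B * q) (A * q - p) := by
  obtain ⟨x, hx, y, hy, h0, h1⟩ := h
  rcases hT.exists_digit hx with ⟨i, hi0, hi, x', hx', hx0, hx1⟩ | ⟨x', hx', hx0, hx1⟩ <;>
  rcases hT.exists_digit hy with ⟨j, hj0, hj, y', hy', hy0, hy1⟩ | ⟨y', hy', hy0, hy1⟩ <;>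
  rw [h0, h1] at hx1 <;> rw [h1] at hx0
  · refine ⟨j - i, Or.inl ⟨abs_le.2 ⟨by linarith, by linarith⟩, x', hx', y', hy', ?_, ?_⟩⟩ <;>
      push_cast <;> linarith
  · refine ⟨i, Or.inr <| Or.inl ⟨hi0, hi, x', hx', y', hy', ?_, ?_⟩⟩ <;>
      push_cast <;> linarith
  · refine ⟨j, Or.inr <| Or.inr <| Or.inl ⟨hj0, hj, x', hx', y', hy', ?_, ?_⟩⟩ <;>
      push_cast <;> linarith
  · refine ⟨0, Or.inr <| Or.inr <| Or.inr ⟨x', hx', y', hy', ?_, ?_⟩⟩ <;>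
      push_cast <;> linarith

/-- The possible successors of a point reflection in the neighbor graph. -/
theorem Meets.neg_one_step {A B : ℤ} {T : Set Pt} (hT : CrysEq A B T) {p q : ℤ}
    (h : Meets T (-1) p q) : ∃ d : ℤ,
      (3 - B ≤ d ∧ d ≤ B - 1 ∧ Meets T (-1) (-B * q + d) (p - A * q)) ∨
      (1 ≤ d ∧ d ≤ B - 1 ∧ Meets T 1 (-B * q + d) (p - A * q)) ∨
      (1 ≤ d ∧ d ≤ B - 1 ∧ Meets T 1 (B * q - d) (A * q - p)) ∨
      Meets T (-1) (B * q - (B - 1)) (A * q - p) := by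
  obtain ⟨x, hx, y, hy, h0, h1⟩ := h
  rcases hT.exists_digit hx with ⟨i, hi0, hi, x', hx', hx0, hx1⟩ | ⟨x', hx', hx0, hx1⟩ <;>
  rcases hT.exists_digit hy with ⟨j, hj0, hj, y', hy', hy0, hy1⟩ | ⟨y', hy', hy0, hy1⟩ <;>
  rw [h0, h1] at hx1 <;> rw [h1] at hx0
  · refine ⟨B - 1 - i - j, Or.inl ⟨by linarith, by linarith, x', hx', y', hy', ?_, ?_⟩⟩ <;>
      push_cast <;> linarith
  · refine ⟨B - 1 - i, Or.inr <| Or.inl ⟨by linarith, by linarith, x', hx', y', hy', ?_, ?_⟩⟩ <;>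
      push_cast <;> linarith
  · refine ⟨B - 1 - j, Or.inr <| Or.inr <| Or.inl
      ⟨by linarith, by linarith, x', hx', y', hy', ?_, ?_⟩⟩ <;>
      push_cast <;> linarith
  · refine ⟨0, Or.inr <| Or.inr <| Or.inr ⟨x', hx', y', hy', ?_, ?_⟩⟩ <;>
      push_cast <;> linarith

theorem exists_abs_le_of_meets {T : Set Pt} (hTc : IsCompact T) :
    ∃ K : ℤ, ∀ p q : ℤ, Meets T 1 p q ∨ Meets T (-1) p q → |q| ≤ K := by
  obtain ⟨C, hC⟩ := hTc.isBounded.exists_norm_le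
  obtain ⟨K, hK⟩ := exists_int_gt (2 * C)
  have hb : ∀ x ∈ T, |x 1| ≤ C := fun x hx => (norm_le_pi_norm x 1).trans (hC x hx)
  refine ⟨K, fun p q h => ?_⟩
  have hq : |(q:ℝ)| ≤ K := by
    rcases h with ⟨x, hx, y, hy, -, h1⟩ | ⟨x, hx, y, hy, -, h1⟩ <;>
    · have hx' := abs_le.1 (hb x hx)
      have hy' := abs_le.1 (hb y hy)
      exact abs_le.2 ⟨by linarith, by linarith⟩
  exact_mod_cast hq

/-- The vectors on infinite bounded walks `w ↦ M w + (d, 0)` with `|d| ≤ B - 1`. -/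
theorem bounded_walk {A B : ℤ} (hA : 3 ≤ A) (hB : 5 ≤ B) (h2A : 2 * A < B + 3)
    {N : ℤ → ℤ → Prop} {K : ℤ} (hK : ∀ p q, N p q → |q| ≤ K)
    (hneg : ∀ p q, N p q → N (-p) (-q))
    (hstep : ∀ p q, N p q → ∃ d, |d| ≤ B - 1 ∧ N (-B * q + d) (p - A * q))
    {p q : ℤ} (h : N p q) :
    |q| ≤ 1 ∧ |p - A * q| ≤ 1 ∧ (q = 1 → p - A * q ≠ 1) ∧ (q = -1 → p - A * q ≠ -1) := by
  have htwo : ∀ p q, N p q → ∃ d, |d| ≤ B - 1 ∧ N (-B * q + d) (p - A * q) ∧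
      ∃ q₂, (∃ p₂, N p₂ q₂) ∧ q₂ = -B * q + d - A * (p - A * q) := by
    intro p q h
    obtain ⟨d, hd, h'⟩ := hstep p q h
    obtain ⟨e, -, h''⟩ := hstep _ _ h'
    exact ⟨d, hd, h', _, ⟨_, h''⟩, rfl⟩
  have hone : ∀ p q, N p q → q ≤ 1 := by
    by_contra! hcon
    obtain ⟨p₀, q₀, h₀, hq₀⟩ := hcon
    obtain ⟨Q, ⟨P, hP⟩, hmax⟩ := Int.exists_greatest_of_bdd (P := fun q => ∃ p, N p q)
      ⟨K, fun z ⟨p, hp⟩ => (le_abs_self z).trans (hK p z hp)⟩ ⟨q₀, p₀, h₀⟩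
    have hQ : 2 ≤ Q := by have := hmax q₀ ⟨p₀, h₀⟩; omega
    have hmin : ∀ p q, N p q → -Q ≤ q := fun p q h => by
      have := hmax _ ⟨_, hneg p q h⟩
      omega
    have key : ∀ P, N P Q → P - A * Q = -Q := by
      intro P hP
      obtain ⟨d, hd, h', q₂, ⟨p₂, h₂⟩, e₂⟩ := htwo P Q hP
      have hd := abs_le.1 hd
      have h3 := hmin _ _ h₂
      have h4 := hmin _ _ h'
      by_contra hne
      have h5 : -Q + 1 ≤ P - A * Q := by omega
      nlinarith
    obtain ⟨d, hd, h', q₂, ⟨p₂, h₂⟩, e₂⟩ := htwo P Q hP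
    have e1 := key P hP
    rw [e1] at h' e₂
    have e2 := key _ (by simpa using hneg _ _ h')
    have hd := abs_le.1 hd
    nlinarith
  have habs : ∀ p q, N p q → |q| ≤ 1 := fun p q h => abs_le.2
    ⟨by have := hone _ _ (hneg p q h); omega, hone p q h⟩
  obtain ⟨d, hd, h', q₂, ⟨p₂, h₂⟩, e₂⟩ := htwo p q h
  have hd := abs_le.1 hd
  have h2' := abs_le.1 (habs _ _ h₂)
  refine ⟨habs _ _ h, habs _ _ h', ?_, ?_⟩
  · rintro rfl h1
    rw [h1] at e₂
    omega
  · rintro rfl h1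
    rw [h1] at e₂
    omega

theorem lattice_neighbors {A B : ℤ} (hA : 3 ≤ A) (hB : 5 ≤ B) (h2A : 2 * A < B + 3)
    {T : Set Pt} (hTc : IsCompact T) (hT : CrysEq A B T) {p q : ℤ}
    (h : Meets T 1 p q ∨ Meets T (-1) p q) :
    (p, q) ∈ ({(0,0), (1,0), (-1,0), (A-1,1), (1-A,-1), (A,1), (-A,-1)} : Set (ℤ × ℤ)) := by
  obtain ⟨K, hK⟩ := exists_abs_le_of_meets hTc
  have hw := bounded_walk hA hB h2A (K := K)
    (N := fun p q => (Meets T 1 p q ∨ Meets T (-1) p q) ∨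
      (Meets T 1 (-p) (-q) ∨ Meets T (-1) (-p) (-q)))
    (by
      rintro p q (h | h)
      · exact hK p q h
      · simpa using hK _ _ h)
    (by
      rintro p q (h | h)
      · exact Or.inr (by simpa using h)
      · exact Or.inl h)
    (by
      have main : ∀ p q, Meets T 1 p q ∨ Meets T (-1) p q → ∃ d, |d| ≤ B - 1 ∧
          ((Meets T 1 (-B * q + d) (p - A * q) ∨ Meets T (-1) (-B * q + d) (p - A * q)) ∨
          (Meets T 1 (-(-B * q + d)) (-(p - A * q)) ∨
            Meets T (-1) (-(-B * q + d)) (-(p - A * q)))) := by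
        rintro p q (h | h)
        · obtain ⟨d, ⟨hd, h⟩ | ⟨hd0, hd, h⟩ | ⟨hd0, hd, h⟩ | h⟩ := h.one_step hT
          · exact ⟨d, by omega, Or.inl (Or.inl h)⟩
          · exact ⟨-d, abs_le.2 ⟨by omega, by omega⟩, Or.inl (Or.inr h)⟩
          · refine ⟨d, abs_le.2 ⟨by omega, by omega⟩, Or.inr (Or.inr ?_)⟩
            convert h using 1 <;> ring
          · refine ⟨0, abs_le.2 ⟨by omega, by omega⟩, Or.inr (Or.inl ?_)⟩
            convert h using 1 <;> ring
        · obtain ⟨d, ⟨hd0, hd, h⟩ | ⟨hd0, hd, h⟩ | ⟨hd0, hd, h⟩ | h⟩ := h.neg_one_step hT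
          · exact ⟨d, abs_le.2 ⟨by omega, by omega⟩, Or.inl (Or.inr h)⟩
          · exact ⟨d, abs_le.2 ⟨by omega, by omega⟩, Or.inl (Or.inl h)⟩
          · refine ⟨d, abs_le.2 ⟨by omega, by omega⟩, Or.inr (Or.inl ?_)⟩
            convert h using 1 <;> ring
          · refine ⟨B - 1, abs_le.2 ⟨by omega, by omega⟩, Or.inr (Or.inr ?_)⟩
            convert h using 1 <;> ring
      rintro p q (h | h)
      · exact main p q h
      · obtain ⟨d, hd, h'⟩ := main _ _ h
        refine ⟨-d, by rwa [abs_neg], ?_⟩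
        have e1 : -B * -q + d = -(-B * q + -d) := by ring
        have e2 : -p - A * -q = -(p - A * q) := by ring
        rw [e1, e2, neg_neg, neg_neg] at h'
        exact h'.symm)
    (Or.inl h)
  obtain ⟨h1, h2, h3, h4⟩ := hw
  simp only [mem_insert_iff, mem_singleton_iff, Prod.mk.injEq]
  have h1 := abs_le.1 h1
  have h2 := abs_le.1 h2
  obtain rfl | rfl | rfl : q = 0 ∨ q = 1 ∨ q = -1 := by omega
  all_goals omega

theorem not_meets_one {A B : ℤ} (hA : 3 ≤ A) (hB : 5 ≤ B) (h2A : 2 * A < B + 3)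
    {T : Set Pt} (hTc : IsCompact T) (hT : CrysEq A B T) : ¬ Meets T 1 A 1 := by
  intro h
  obtain ⟨d, ⟨hd, h⟩ | ⟨hd0, hd, h⟩ | ⟨hd0, hd, h⟩ | h⟩ := h.one_step hT
  · have h := lattice_neighbors hA hB h2A hTc hT (Or.inl h)
    have hd := abs_le.1 hd
    simp only [mem_insert_iff, mem_singleton_iff, Prod.mk.injEq] at h
    omega
  · have h := lattice_neighbors hA hB h2A hTc hT (Or.inr h)
    simp only [mem_insert_iff, mem_singleton_iff, Prod.mk.injEq] at h
    omega
  · have h := lattice_neighbors hA hB h2A hTc hT (Or.inr h)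
    simp only [mem_insert_iff, mem_singleton_iff, Prod.mk.injEq] at h
    omega
  · have h := lattice_neighbors hA hB h2A hTc hT (Or.inl h)
    simp only [mem_insert_iff, mem_singleton_iff, Prod.mk.injEq] at h
    omega

theorem not_meets_neg_one {A B : ℤ} (hA : 3 ≤ A) (hB : 5 ≤ B) (h2A : 2 * A < B + 3)
    {T : Set Pt} (hTc : IsCompact T) (hT : CrysEq A B T) : ¬ Meets T (-1) (-A) (-1) := by
  intro h
  obtain ⟨d, ⟨hd0, hd, h⟩ | ⟨hd0, hd, h⟩ | ⟨hd0, hd, h⟩ | h⟩ := h.neg_one_step hT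
  · have h := lattice_neighbors hA hB h2A hTc hT (Or.inr h)
    simp only [mem_insert_iff, mem_singleton_iff, Prod.mk.injEq] at h
    omega
  · have h := lattice_neighbors hA hB h2A hTc hT (Or.inl h)
    simp only [mem_insert_iff, mem_singleton_iff, Prod.mk.injEq] at h
    omega
  · have h := lattice_neighbors hA hB h2A hTc hT (Or.inl h)
    simp only [mem_insert_iff, mem_singleton_iff, Prod.mk.injEq] at h
    omega
  · have h := lattice_neighbors hA hB h2A hTc hT (Or.inr h)
    simp only [mem_insert_iff, mem_singleton_iff, Prod.mk.injEq] at h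
    omega

/-- In the norm `|a| + 3/2 |b|`, the inverse of `M` is a contraction. -/
theorem weighted_norm_contraction {A B a b : ℝ} (hA : 3 ≤ A) (hB : 5 ≤ B) (hAB : A + 2 ≤ B) :
    |a| + 3 / 2 * |b| ≤ (1 - 1 / (2 * B)) * (|-B * b| + 3 / 2 * |a - A * b|) := by
  have hB0 : 0 < B := by linarith
  have ha : |a| ≤ |a - A * b| + A * |b| := by
    have := abs_add_le (a - A * b) (A * b)
    rwa [sub_add_cancel, abs_mul A b, abs_of_pos (by linarith : 0 < A)] at this
  have hb : |-B * b| = B * |b| := by rw [abs_mul, abs_neg, abs_of_pos hB0]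
  have h1 : 1 / (2 * B) ≤ 1 / 10 := by
    apply one_div_le_one_div_of_le <;> linarith
  have h2 : 1 / (2 * B) * (B * |b|) = |b| / 2 := by field_simp
  have h3 : (A + 2) * |b| ≤ B * |b| := by gcongr
  have h4 : 1 / (2 * B) * |a - A * b| ≤ 1 / 10 * |a - A * b| := by gcongr
  have h5 := abs_nonneg (a - A * b)
  rw [hb]
  linarith

/-- A finite set of isometries in which every element has a successor consists of neighbors. -/
theorem meets_of_walk {A B : ℤ} (hA : 3 ≤ A) (hB : 5 ≤ B) (h2A : 2 * A < B + 3)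
    {T : Set Pt} (hTne : T.Nonempty) (hTc : IsCompact T) (hT : CrysEq A B T)
    (ε : ℝ) {W : Set (ℤ × ℤ)} (hW : W.Finite)
    (hstep : ∀ w ∈ W, ∃ w' ∈ W, ∃ i j : ℤ, 0 ≤ i ∧ i ≤ B - 2 ∧ 0 ≤ j ∧ j ≤ B - 2 ∧
      (w'.1 : ℝ) = -B * w.2 + (1 - ε) * ((B - 1) / 2) - i + ε * j ∧ w'.2 = w.1 - A * w.2)
    {w : ℤ × ℤ} (hw : w ∈ W) : Meets T ε w.1 w.2 := by
  let F : ℤ × ℤ → Pt × Pt → ℝ := fun w z =>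
    |z.1 0 - ε * z.2 0 - w.1| + 3 / 2 * |z.1 1 - ε * z.2 1 - w.2|
  have hAB : A + 2 ≤ B := by omega
  have hA' : (3:ℝ) ≤ A := by exact_mod_cast hA
  have hB' : (5:ℝ) ≤ B := by exact_mod_cast hB
  have hAB' : (A:ℝ) + 2 ≤ B := by exact_mod_cast hAB
  obtain ⟨l, hl⟩ : ∃ l : ℝ, l = 1 - 1 / (2 * (B:ℝ)) := ⟨_, rfl⟩
  have hl0 : 0 ≤ l := by
    have : 1 / (2 * (B:ℝ)) ≤ 1 := by rw [div_le_one] <;> linarith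
    linarith
  have hl1 : l < 1 := by
    have : 0 < 1 / (2 * (B:ℝ)) := by positivity
    linarith
  obtain ⟨t, ht⟩ := hTne
  obtain ⟨R, hR⟩ := (hW.image fun w => F w (t, t)).bddAbove
  have hiter : ∀ n : ℕ, ∀ w ∈ W, ∃ z ∈ T ×ˢ T, F w z ≤ l ^ n * R := by
    intro n
    induction n with
    | zero => exact fun w hw => ⟨(t, t), ⟨ht, ht⟩, by simpa using hR (mem_image_of_mem _ hw)⟩
    | succ n ih =>
      intro w hw
      obtain ⟨w', hw', i, j, hi0, hi, hj0, hj, e1, e2⟩ := hstep w hw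
      obtain ⟨⟨x', y'⟩, ⟨hx', hy'⟩, hle⟩ := ih w' hw'
      obtain ⟨x, hx, hx0, hx1⟩ := hT.exists_preimage hx' hi0 hi
      obtain ⟨y, hy, hy0, hy1⟩ := hT.exists_preimage hy' hj0 hj
      refine ⟨(x, y), ⟨hx, hy⟩, ?_⟩
      have e2' : (w'.2 : ℝ) = w.1 - A * w.2 := by exact_mod_cast e2
      have hc := weighted_norm_contraction (a := x 0 - ε * y 0 - w.1)
        (b := x 1 - ε * y 1 - w.2) hA' hB' hAB'
      have h0 : -(B:ℝ) * (x 1 - ε * y 1 - w.2) = x' 0 - ε * y' 0 - w'.1 := by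
        rw [e1]; linear_combination hx0 - ε * hy0
      have h1 : x 0 - ε * y 0 - w.1 - A * (x 1 - ε * y 1 - w.2) = x' 1 - ε * y' 1 - w'.2 := by
        rw [e2']; linear_combination hx1 - ε * hy1
      rw [h0, h1, ← hl] at hc
      calc F w (x, y) ≤ l * F w' (x', y') := hc
        _ ≤ l * (l ^ n * R) := by gcongr
        _ = l ^ (n + 1) * R := by ring
  have hcont : Continuous (F w) := by fun_prop
  obtain ⟨⟨x, y⟩, ⟨hx, hy⟩, hmin⟩ :=
    (hTc.prod hTc).exists_isMinOn ⟨(t, t), ht, ht⟩ hcont.continuousOn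
  have hle : F w (x, y) ≤ 0 := by
    have hlim : Filter.Tendsto (fun n : ℕ => l ^ n * R) Filter.atTop (nhds 0) := by
      simpa using (tendsto_pow_atTop_nhds_zero_of_lt_one hl0 hl1).mul_const R
    refine ge_of_tendsto' hlim fun n => ?_
    obtain ⟨z, hz, hle⟩ := hiter n w hw
    exact (hmin hz).trans hle
  have ha := abs_nonneg (x 0 - ε * y 0 - w.1)
  have hb := abs_nonneg (x 1 - ε * y 1 - w.2)
  have hle' : |x 0 - ε * y 0 - w.1| + 3 / 2 * |x 1 - ε * y 1 - w.2| ≤ 0 := hle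
  have ha0 := abs_eq_zero.1 (le_antisymm (by linarith) ha)
  have hb0 := abs_eq_zero.1 (le_antisymm (by linarith) hb)
  exact ⟨x, hx, y, hy, by linarith, by linarith⟩

theorem stmt_9 (A B : ℤ) (hA : 3 ≤ A) (hB : 5 ≤ B) (hAB : A ≤ B) (h2A : 2 * A < B + 3)
    (T : Set Pt) (hTne : T.Nonempty) (hTc : IsCompact T) (hT : CrysEq A B T) :
    (∀ p q : ℤ, ¬(p = 0 ∧ q = 0) →
      ((T ∩ (fun x : Pt => x + ![(p:ℝ), (q:ℝ)]) '' T).Nonempty ↔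
        (p, q) ∈ ({(1,0), (-1,0), (A-1,1), (1-A,-1)} : Set (ℤ × ℤ)))) ∧
    (∀ p q : ℤ,
      ((T ∩ (fun x : Pt => -x + ![(p:ℝ), (q:ℝ)]) '' T).Nonempty ↔
        (p, q) ∈ ({(0,0), (1,0), (-1,0), (A-1,1), (1-A,-1), (A,1)} : Set (ℤ × ℤ)))) := by
  constructor
  · intro p q hpq
    rw [meets_one_iff]
    constructor
    · intro h
      have hn := lattice_neighbors hA hB h2A hTc hT (Or.inl h)
      have hne := not_meets_one hA hB h2A hTc hT
      simp only [mem_insert_iff, mem_singleton_iff, Prod.mk.injEq] at hn ⊢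
      rcases hn with hn | hn | hn | hn | hn | ⟨rfl, rfl⟩ | ⟨rfl, rfl⟩
      · exact absurd hn hpq
      · exact Or.inl hn
      · exact Or.inr (Or.inl hn)
      · exact Or.inr (Or.inr (Or.inl hn))
      · exact Or.inr (Or.inr (Or.inr hn))
      · exact absurd h hne
      · exact absurd (by simpa using h.one_neg) hne
    · refine meets_of_walk hA hB h2A hTne hTc hT 1 (by simp) ?_
      rintro w (rfl | rfl | rfl | rfl)
      · refine ⟨(A - 1, 1), by simp, 0, A - 1, ?_⟩
        refine ⟨by omega, by omega, by omega, by omega, ?_, by simp⟩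
        push_cast; ring
      · refine ⟨(1 - A, -1), by simp, A - 1, 0, ?_⟩
        refine ⟨by omega, by omega, by omega, by omega, ?_, by simp⟩
        push_cast; ring
      · refine ⟨(1 - A, -1), by simp, 0, B + 1 - A, ?_⟩
        refine ⟨by omega, by omega, by omega, by omega, ?_, by simp⟩
        push_cast; ring
      · refine ⟨(A - 1, 1), by simp, B + 1 - A, 0, ?_⟩
        refine ⟨by omega, by omega, by omega, by omega, ?_, by simp⟩
        push_cast; ring
  · intro p q
    rw [meets_neg_one_iff]
    constructor
    · intro h
      have hn := lattice_neighbors hA hB h2A hTc hT (Or.inr h)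
      have hne := not_meets_neg_one hA hB h2A hTc hT
      simp only [mem_insert_iff, mem_singleton_iff, Prod.mk.injEq] at hn ⊢
      by_cases hpq : p = -A ∧ q = -1
      · obtain ⟨rfl, rfl⟩ := hpq
        exact absurd h hne
      · tauto
    · refine meets_of_walk hA hB h2A hTne hTc hT (-1) (by simp) ?_
      rintro w (rfl | rfl | rfl | rfl | rfl | rfl)
      · refine ⟨(0, 0), by simp, B - 2, 1, ?_⟩
        refine ⟨by omega, by omega, by omega, by omega, ?_, by simp⟩
        push_cast; ring
      · refine ⟨(A - 1, 1), by simp, B - A, 0, ?_⟩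
        refine ⟨by omega, by omega, by omega, by omega, ?_, by simp⟩
        push_cast; ring
      · refine ⟨(1 - A, -1), by simp, B - 2, A, ?_⟩
        refine ⟨by omega, by omega, by omega, by omega, ?_, by simp⟩
        push_cast; ring
      · refine ⟨(1 - A, -1), by simp, A - 2, 0, ?_⟩
        refine ⟨by omega, by omega, by omega, by omega, ?_, by simp⟩
        push_cast; ring
      · refine ⟨(A, 1), by simp, B - 2, B + 1 - A, ?_⟩
        refine ⟨by omega, by omega, by omega, by omega, ?_, by simp⟩
        push_cast; ring
      · refine ⟨(-1, 0), by simp, 0, 0, ?_⟩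
        refine ⟨by omega, by omega, by omega, by omega, ?_, by simp⟩
        push_cast; ring
end
end

section
/- Let A = 1 and let B ≥ 2 be an integer, let M be the 2×2 real matrix with rows (0, −B) and (1, −1), and let T be the unique nonempty compact subset of ℝ² satisfying M·T + ((B−1)/2, 0) = (⋃_{i=0}^{B−2} (T + (i,0))) ∪ (−T). Then for γ in the p2 group Γ with γ ≠ id, one has T ∩ γ(T) ≠ ∅ if and only if γ is one of the following six isometries: a translation x ↦ x + w with w ∈ {(1,0), (−1,0)}, or a point reflection x ↦ −x + w with w ∈ {(0,0), (1,0), (1,1), (0,1)}. -/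
open Set Pointwise

noncomputable section

/-- `(x, y)` is a sum of two points of `T`. -/
def IsSumOf (T : Set Pt) (x y : ℝ) : Prop :=
  ∃ t ∈ T, ∃ s ∈ T, t 0 + s 0 = x ∧ t 1 + s 1 = y

/-- `(x, y)` is a difference of two points of `T`. -/
def IsDiffOf (T : Set Pt) (x y : ℝ) : Prop :=
  ∃ t ∈ T, ∃ s ∈ T, t 0 - s 0 = x ∧ t 1 - s 1 = y

theorem IsDiffOf.neg {T : Set Pt} {x y : ℝ} (h : IsDiffOf T x y) : IsDiffOf T (-x) (-y) := by
  obtain ⟨t, ht, s, hs, h0, h1⟩ := h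
  exact ⟨s, hs, t, ht, by linarith, by linarith⟩

theorem inter_add_nonempty_iff (T : Set Pt) (x y : ℝ) :
    (T ∩ (fun z : Pt => z + ![x, y]) '' T).Nonempty ↔ IsDiffOf T x y := by
  constructor
  · rintro ⟨_, ht, s, hs, rfl⟩
    exact ⟨_, ht, s, hs, by simp, by simp⟩
  · rintro ⟨t, ht, s, hs, h0, h1⟩
    refine ⟨t, ht, s, hs, ?_⟩
    ext i
    fin_cases i
    · simp [← h0]
    · simp [← h1]

theorem inter_neg_add_nonempty_iff (T : Set Pt) (x y : ℝ) :
    (T ∩ (fun z : Pt => -z + ![x, y]) '' T).Nonempty ↔ IsSumOf T x y := by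
  constructor
  · rintro ⟨_, ht, s, hs, rfl⟩
    exact ⟨_, ht, s, hs, by simp, by simp⟩
  · rintro ⟨t, ht, s, hs, h0, h1⟩
    refine ⟨t, ht, s, hs, ?_⟩
    ext i
    fin_cases i
    · simp [← h0]
    · simp [← h1]

section CrysEq

variable {B : ℤ} {T : Set Pt}

theorem CrysEq.exists_image (hT : CrysEq 1 B T) {t : Pt} (ht : t ∈ T) :
    ∃ u ∈ T, (∃ i : ℤ, 0 ≤ i ∧ i ≤ B - 2 ∧
        -B * t 1 + (B - 1) / 2 = u 0 + i ∧ t 0 - t 1 = u 1) ∨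
      (-B * t 1 + (B - 1) / 2 = -u 0 ∧ t 0 - t 1 = -u 1) := by
  have h := hT.subset (mem_image_of_mem _ ht)
  simp only [mem_union, mem_iUnion, Finset.mem_Icc, mem_image, Set.mem_neg] at h
  rcases h with ⟨i, ⟨hi0, hi1⟩, u, hu, h⟩ | h
  · have h0 := congrFun h 0
    have h1 := congrFun h 1
    simp [dotProduct, Fin.sum_univ_two] at h0 h1
    exact ⟨u, hu, .inl ⟨i, hi0, hi1, by linarith, by linarith⟩⟩
  · refine ⟨_, h, .inr ⟨?_, ?_⟩⟩
    · simp [dotProduct, Fin.sum_univ_two]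
    · simp [dotProduct, Fin.sum_univ_two]
      ring

theorem CrysEq.exists_preimage_add (hT : CrysEq 1 B T) {u : Pt} (hu : u ∈ T) {i : ℤ}
    (hi0 : 0 ≤ i) (hi1 : i ≤ B - 2) :
    ∃ t ∈ T, -B * t 1 + (B - 1) / 2 = u 0 + i ∧ t 0 - t 1 = u 1 := by
  have h : u + ![(i : ℝ), 0] ∈ (⋃ i ∈ Finset.Icc (0:ℤ) (B-2),
      (fun x : Pt => x + ![(i:ℝ), 0]) '' T) ∪ (-T) := by
    refine .inl ?_
    simp only [mem_iUnion, Finset.mem_Icc]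
    exact ⟨i, ⟨hi0, hi1⟩, mem_image_of_mem _ hu⟩
  obtain ⟨t, ht, h⟩ := hT.superset h
  have h0 := congrFun h 0
  have h1 := congrFun h 1
  simp [dotProduct, Fin.sum_univ_two] at h0 h1
  exact ⟨t, ht, by linarith, by linarith⟩

theorem CrysEq.exists_preimage_neg (hT : CrysEq 1 B T) {u : Pt} (hu : u ∈ T) :
    ∃ t ∈ T, -B * t 1 + (B - 1) / 2 = -u 0 ∧ t 0 - t 1 = -u 1 := by
  have h : -u ∈ (⋃ i ∈ Finset.Icc (0:ℤ) (B-2),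
      (fun x : Pt => x + ![(i:ℝ), 0]) '' T) ∪ (-T) := .inr (by simpa using hu)
  obtain ⟨t, ht, h⟩ := hT.superset h
  have h0 := congrFun h 0
  have h1 := congrFun h 1
  simp [dotProduct, Fin.sum_univ_two] at h0 h1
  exact ⟨t, ht, by linarith, by linarith⟩

/-- The quadratic form `x² - xy + By²` is scaled by `B` under `!![0, -B; 1, -1]`; comparing its
maximum on `T` with the value at the image bounds it. -/
theorem CrysEq.quadForm_le (hB : 2 ≤ B) (hTc : IsCompact T) (hT : CrysEq 1 B T) {t : Pt}
    (ht : t ∈ T) : t 0 ^ 2 - t 0 * t 1 + B * t 1 ^ 2 ≤ ((√B + 1) / 2) ^ 2 := by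
  have hB' : (2 : ℝ) ≤ B := by exact_mod_cast hB
  obtain ⟨m, hm, hmax⟩ := hTc.exists_isMaxOn ⟨t, ht⟩
    (f := fun t : Pt => t 0 ^ 2 - t 0 * t 1 + B * t 1 ^ 2) (by fun_prop)
  have hmax' : ∀ u ∈ T, u 0 ^ 2 - u 0 * u 1 + B * u 1 ^ 2 ≤
      m 0 ^ 2 - m 0 * m 1 + B * m 1 ^ 2 := fun u hu => hmax hu
  refine (hmax' t ht).trans ?_
  set Q := m 0 ^ 2 - m 0 * m 1 + B * m 1 ^ 2 with hQ
  have hQ0 : 0 ≤ Q := by nlinarith [sq_nonneg (m 0 - m 1 / 2), sq_nonneg (m 1)]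
  obtain ⟨x, y, a, ha, hxy, hx, hy⟩ : ∃ x y a : ℝ, |a| ≤ (B - 1) / 2 ∧
      x ^ 2 - x * y + B * y ^ 2 ≤ Q ∧ -B * m 1 = x + a ∧ m 0 - m 1 = y := by
    obtain ⟨u, hu, ⟨i, hi0, hi1, h0, h1⟩ | ⟨h0, h1⟩⟩ := hT.exists_image hm
    · have hi0' : (0 : ℝ) ≤ i := by exact_mod_cast hi0
      have hi1' : (i : ℝ) ≤ B - 2 := by exact_mod_cast hi1
      exact ⟨u 0, u 1, i - (B - 1) / 2, by rw [abs_le]; constructor <;> linarith,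
        hmax' u hu, by linarith, h1⟩
    · exact ⟨-u 0, -u 1, -((B - 1) / 2), by rw [abs_le]; constructor <;> linarith,
        by nlinarith [hmax' u hu], by linarith, h1⟩
  set r := √Q with hr
  have hr0 : 0 ≤ r := Real.sqrt_nonneg _
  have hr2 : r ^ 2 = Q := Real.sq_sqrt hQ0
  set b := √(B : ℝ) with hb
  have hb0 : 0 ≤ b := Real.sqrt_nonneg _
  have hb2 : b ^ 2 = B := Real.sq_sqrt (by linarith)
  have hb1 : 1 < b := by nlinarith
  have hlin : |x - y / 2| ≤ r := by
    apply abs_le_of_sq_le_sq _ hr0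
    nlinarith [sq_nonneg y]
  have hprod : a * (x - y / 2) ≤ (B - 1) / 2 * r :=
    (le_abs_self _).trans (by
      rw [abs_mul]; exact mul_le_mul ha hlin (abs_nonneg _) (by linarith))
  have ha2 : a ^ 2 ≤ ((B - 1) / 2) ^ 2 := sq_le_sq' (by linarith [(abs_le.1 ha).1]) (abs_le.1 ha).2
  have hscale : B * Q = (x + a) ^ 2 - (x + a) * y + B * y ^ 2 := by
    rw [← hx, ← hy, hQ]; ring
  have hsq : (b * r) ^ 2 ≤ (r + (B - 1) / 2) ^ 2 := by
    rw [mul_pow, hb2, hr2]; nlinarith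
  have hle : b * r ≤ r + (B - 1) / 2 :=
    (abs_le_of_sq_le_sq' hsq (by linarith)).2
  have : r ≤ (b + 1) / 2 := by
    rw [← hb2] at hle
    by_contra! h
    nlinarith [mul_pos (sub_pos.2 hb1) (sub_pos.2 h)]
  rw [← hr2]
  gcongr

theorem CrysEq.abs_snd_lt_one (hB : 2 ≤ B) (hTc : IsCompact T) (hT : CrysEq 1 B T) {t : Pt}
    (ht : t ∈ T) : |t 1| < 1 := by
  have hB' : (2 : ℝ) ≤ B := by exact_mod_cast hB
  have h := hT.quadForm_le hB hTc ht
  have hb2 : √(B : ℝ) ^ 2 = B := Real.sq_sqrt (by linarith)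
  rw [← sq_lt_one_iff_abs_lt_one]
  by_contra! h1
  nlinarith [sq_nonneg (t 0 - t 1 / 2), sq_nonneg (√(B : ℝ) - 1),
    mul_nonneg (sub_nonneg.2 h1) (sub_nonneg.2 hB')]

theorem CrysEq.abs_fst_sub_snd_lt_one (hB : 2 ≤ B) (hTc : IsCompact T) (hT : CrysEq 1 B T)
    {t : Pt} (ht : t ∈ T) : |t 0 - t 1| < 1 := by
  obtain ⟨u, hu, ⟨_, _, _, _, h⟩ | ⟨_, h⟩⟩ := hT.exists_image ht
  · rw [h]; exact hT.abs_snd_lt_one hB hTc hu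
  · rw [h, abs_neg]; exact hT.abs_snd_lt_one hB hTc hu

theorem CrysEq.bounds_of_isSumOf (hB : 2 ≤ B) (hTc : IsCompact T) (hT : CrysEq 1 B T)
    {p q : ℤ} (h : IsSumOf T p q) : (-1 ≤ q ∧ q ≤ 1) ∧ -1 ≤ p - q ∧ p - q ≤ 1 := by
  obtain ⟨t, ht, s, hs, h0, h1⟩ := h
  have a := abs_lt.1 (hT.abs_snd_lt_one hB hTc ht)
  have b := abs_lt.1 (hT.abs_snd_lt_one hB hTc hs)
  have c := abs_lt.1 (hT.abs_fst_sub_snd_lt_one hB hTc ht)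
  have d := abs_lt.1 (hT.abs_fst_sub_snd_lt_one hB hTc hs)
  have e1 : (-2 : ℤ) < q := by rify; linarith
  have e2 : q < 2 := by rify; linarith
  have e3 : (-2 : ℤ) < p - q := by rify; linarith
  have e4 : p - q < 2 := by rify; linarith
  omega

theorem CrysEq.bounds_of_isDiffOf (hB : 2 ≤ B) (hTc : IsCompact T) (hT : CrysEq 1 B T)
    {p q : ℤ} (h : IsDiffOf T p q) : (-1 ≤ q ∧ q ≤ 1) ∧ -1 ≤ p - q ∧ p - q ≤ 1 := by
  obtain ⟨t, ht, s, hs, h0, h1⟩ := h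
  have a := abs_lt.1 (hT.abs_snd_lt_one hB hTc ht)
  have b := abs_lt.1 (hT.abs_snd_lt_one hB hTc hs)
  have c := abs_lt.1 (hT.abs_fst_sub_snd_lt_one hB hTc ht)
  have d := abs_lt.1 (hT.abs_fst_sub_snd_lt_one hB hTc hs)
  have e1 : (-2 : ℤ) < q := by rify; linarith
  have e2 : q < 2 := by rify; linarith
  have e3 : (-2 : ℤ) < p - q := by rify; linarith
  have e4 : p - q < 2 := by rify; linarith
  omega

theorem CrysEq.isDiffOf_succ (hT : CrysEq 1 B T) {p q : ℤ} (h : IsDiffOf T p q) :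
    ∃ p' q' : ℤ,
      (IsDiffOf T p' q' ∧ ((q' = p - q ∧ -B * q - (B - 2) ≤ p' ∧ p' ≤ -B * q + (B - 2)) ∨
        (q' = q - p ∧ p' = B * q))) ∨
      (IsSumOf T p' q' ∧ ((q' = p - q ∧ -B * q - (B - 2) ≤ p' ∧ p' ≤ -B * q) ∨
        (q' = q - p ∧ B * q - (B - 2) ≤ p' ∧ p' ≤ B * q))) := by
  obtain ⟨t, ht, s, hs, h0, h1⟩ := h
  have h1' := congrArg ((B : ℝ) * ·) h1
  simp only [mul_sub] at h1'
  obtain ⟨u, hu, ⟨i, hi0, hi1, hu0, hu1⟩ | ⟨hu0, hu1⟩⟩ := hT.exists_image ht <;>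
  obtain ⟨v, hv, ⟨j, hj0, hj1, hv0, hv1⟩ | ⟨hv0, hv1⟩⟩ := hT.exists_image hs
  · exact ⟨-B * q - (i - j), p - q, .inl ⟨⟨u, hu, v, hv, by push_cast; linarith,
      by push_cast; linarith⟩, .inl ⟨rfl, by omega, by omega⟩⟩⟩
  · exact ⟨-B * q - i, p - q, .inr ⟨⟨u, hu, v, hv, by push_cast; linarith,
      by push_cast; linarith⟩, .inl ⟨rfl, by omega, by omega⟩⟩⟩
  · exact ⟨B * q - j, q - p, .inr ⟨⟨u, hu, v, hv, by push_cast; linarith,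
      by push_cast; linarith⟩, .inr ⟨rfl, by omega, by omega⟩⟩⟩
  · exact ⟨B * q, q - p, .inl ⟨⟨u, hu, v, hv, by push_cast; linarith,
      by push_cast; linarith⟩, .inr ⟨rfl, rfl⟩⟩⟩

theorem CrysEq.isSumOf_succ (hT : CrysEq 1 B T) {p q : ℤ} (h : IsSumOf T p q) :
    ∃ p' q' : ℤ,
      (IsSumOf T p' q' ∧ ((q' = p - q ∧ -B * q - (B - 3) ≤ p' ∧ p' ≤ -B * q + (B - 1)) ∨
        (q' = q - p ∧ p' = B * q - (B - 1)))) ∨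
      (IsDiffOf T p' q' ∧ q' = p - q ∧ -B * q + 1 ≤ p' ∧ p' ≤ -B * q + (B - 1)) := by
  obtain ⟨t, ht, s, hs, h0, h1⟩ := h
  have h1' := congrArg ((B : ℝ) * ·) h1
  simp only [mul_add] at h1'
  obtain ⟨u, hu, ⟨i, hi0, hi1, hu0, hu1⟩ | ⟨hu0, hu1⟩⟩ := hT.exists_image ht <;>
  obtain ⟨v, hv, ⟨j, hj0, hj1, hv0, hv1⟩ | ⟨hv0, hv1⟩⟩ := hT.exists_image hs
  · exact ⟨-B * q + (B - 1) - (i + j), p - q, .inl ⟨⟨u, hu, v, hv, by push_cast; linarith,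
      by push_cast; linarith⟩, .inl ⟨rfl, by omega, by omega⟩⟩⟩
  · exact ⟨-B * q + (B - 1) - i, p - q, .inr ⟨⟨u, hu, v, hv, by push_cast; linarith,
      by push_cast; linarith⟩, rfl, by omega, by omega⟩⟩
  · exact ⟨-B * q + (B - 1) - j, p - q, .inr ⟨⟨v, hv, u, hu, by push_cast; linarith,
      by push_cast; linarith⟩, rfl, by omega, by omega⟩⟩
  · exact ⟨B * q - (B - 1), q - p, .inl ⟨⟨u, hu, v, hv, by push_cast; linarith,
      by push_cast; linarith⟩, .inr ⟨rfl, rfl⟩⟩⟩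

theorem CrysEq.isSumOf_restrict (hB : 2 ≤ B) (hTc : IsCompact T) (hT : CrysEq 1 B T)
    {p q : ℤ} (h : IsSumOf T p q) :
    (0 ≤ q ∧ p - q ≤ 0 ∨ q = 0) ∧ (-1 ≤ q ∧ q ≤ 1) ∧ -1 ≤ p - q ∧ p - q ≤ 1 := by
  have hb := hT.bounds_of_isSumOf hB hTc h
  refine ⟨?_, hb⟩
  obtain ⟨⟨hq0, hq1⟩, hp0, hp1⟩ := hb
  obtain ⟨p', q', ⟨h', hd⟩ | ⟨h', hd⟩⟩ := hT.isSumOf_succ h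
  · have := hT.bounds_of_isSumOf hB hTc h'
    interval_cases q <;> omega
  · have := hT.bounds_of_isDiffOf hB hTc h'
    interval_cases q <;> omega

theorem CrysEq.mem_of_isSumOf (hB : 2 ≤ B) (hTc : IsCompact T) (hT : CrysEq 1 B T)
    {p q : ℤ} (h : IsSumOf T p q) : 0 ≤ p ∧ p ≤ 1 ∧ 0 ≤ q ∧ q ≤ 1 := by
  obtain ⟨hr, ⟨hq0, hq1⟩, hp0, hp1⟩ := hT.isSumOf_restrict hB hTc h
  obtain ⟨p', q', ⟨h', hd⟩ | ⟨h', hd⟩⟩ := hT.isSumOf_succ h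
  · have := hT.isSumOf_restrict hB hTc h'
    interval_cases q <;> omega
  · have := hT.bounds_of_isDiffOf hB hTc h'
    interval_cases q <;> omega

theorem CrysEq.isDiffOf_restrict (hB : 2 ≤ B) (hTc : IsCompact T) (hT : CrysEq 1 B T)
    {p q : ℤ} (h : IsDiffOf T p q) :
    (q ≠ 0 → p = 0) ∧ (-1 ≤ q ∧ q ≤ 1) ∧ -1 ≤ p - q ∧ p - q ≤ 1 := by
  have hb := hT.bounds_of_isDiffOf hB hTc h
  refine ⟨?_, hb⟩
  obtain ⟨⟨hq0, hq1⟩, hp0, hp1⟩ := hb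
  obtain ⟨p', q', ⟨h', hd⟩ | ⟨h', hd⟩⟩ := hT.isDiffOf_succ h
  · have := hT.bounds_of_isDiffOf hB hTc h'
    interval_cases q <;> omega
  · have := hT.mem_of_isSumOf hB hTc h'
    interval_cases q <;> omega

theorem CrysEq.mem_of_isDiffOf (hB : 2 ≤ B) (hTc : IsCompact T) (hT : CrysEq 1 B T)
    {p q : ℤ} (h : IsDiffOf T p q) : q = 0 ∧ -1 ≤ p ∧ p ≤ 1 := by
  obtain ⟨hr, ⟨hq0, hq1⟩, hp0, hp1⟩ := hT.isDiffOf_restrict hB hTc h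
  obtain ⟨p', q', ⟨h', hd⟩ | ⟨h', hd⟩⟩ := hT.isDiffOf_succ h
  · have := hT.isDiffOf_restrict hB hTc h'
    interval_cases q <;> omega
  · have := hT.mem_of_isSumOf hB hTc h'
    interval_cases q <;> omega

theorem CrysEq.isSumOf_zero_one_add (hB : 2 ≤ B) (hT : CrysEq 1 B T) {e f : ℝ}
    (h : IsSumOf T (1 + e) (1 + f)) : IsSumOf T (0 + (e / B - f)) (1 + e / B) := by
  have hB' : (0 : ℝ) < B := by exact_mod_cast (by omega : 0 < B)
  obtain ⟨u, hu, v, hv, h0, h1⟩ := h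
  obtain ⟨t, ht, ht0, ht1⟩ := hT.exists_preimage_neg hu
  obtain ⟨s, hs, hs0, hs1⟩ := hT.exists_preimage_neg hv
  have key : t 1 + s 1 = 1 + e / B := by field_simp; linarith
  exact ⟨t, ht, s, hs, by linarith, key⟩

theorem CrysEq.isDiffOf_neg_one_zero_add (hB : 2 ≤ B) (hT : CrysEq 1 B T) {e f : ℝ}
    (h : IsSumOf T (0 + e) (1 + f)) : IsDiffOf T (-1 + (e / B - f)) (0 + e / B) := by
  have hB' : (0 : ℝ) < B := by exact_mod_cast (by omega : 0 < B)
  obtain ⟨u, hu, v, hv, h0, h1⟩ := h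
  obtain ⟨t, ht, ht0, ht1⟩ := hT.exists_preimage_neg hu
  obtain ⟨s, hs, hs0, hs1⟩ := hT.exists_preimage_add hv le_rfl (by omega)
  push_cast at hs0
  have key : t 1 - s 1 = 0 + e / B := by field_simp; linarith
  exact ⟨t, ht, s, hs, by linarith, key⟩

theorem CrysEq.isSumOf_one_one_add (hB : 2 ≤ B) (hT : CrysEq 1 B T) {e f : ℝ}
    (h : IsDiffOf T (-1 + e) (0 + f)) : IsSumOf T (1 - (e / B - f)) (1 - e / B) := by
  have hB' : (0 : ℝ) < B := by exact_mod_cast (by omega : 0 < B)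
  obtain ⟨u, hu, v, hv, h0, h1⟩ := h
  obtain ⟨t, ht, ht0, ht1⟩ := hT.exists_preimage_add hu le_rfl (by omega)
  obtain ⟨s, hs, hs0, hs1⟩ := hT.exists_preimage_neg hv
  push_cast at ht0
  have key : t 1 + s 1 = 1 - e / B := by field_simp; linarith
  exact ⟨t, ht, s, hs, by linarith, key⟩

/-- Going once around the cycle of neighbours `-x + (1,1)`, `x + (-1,0)`, `-x + (0,1)` divides the
quadratic form of the error by `B ^ 3`, so the minimal error vanishes. -/
theorem CrysEq.isSumOf_one_one (hB : 2 ≤ B) (hTne : T.Nonempty) (hTc : IsCompact T)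
    (hT : CrysEq 1 B T) : IsSumOf T 1 1 := by
  have hB' : (2 : ℝ) ≤ B := by exact_mod_cast hB
  let q : ℝ → ℝ → ℝ := fun x y => x ^ 2 - x * y + B * y ^ 2
  have hq : ∀ e f : ℝ, q (e / B - f) (e / B) = q e f / B := by
    intro e f
    simp only [q]
    field_simp
    ring
  obtain ⟨⟨u, v⟩, ⟨hu, hv⟩, hmin⟩ := (hTc.prod hTc).exists_isMinOn (hTne.prod hTne)
    (f := fun z : Pt × Pt => q (z.1 0 + z.2 0 - 1) (z.1 1 + z.2 1 - 1))
    (by simp only [q]; fun_prop)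
  set e := u 0 + v 0 - 1 with he
  set f := u 1 + v 1 - 1 with hf
  have h : IsSumOf T (1 + e) (1 + f) :=
    ⟨u, hu, v, hv, by rw [he]; ring, by rw [hf]; ring⟩
  obtain ⟨t, ht, s, hs, h0, h1⟩ := hT.isSumOf_one_one_add hB
    (hT.isDiffOf_neg_one_zero_add hB (hT.isSumOf_zero_one_add hB h))
  have hle : q e f ≤ q (t 0 + s 0 - 1) (t 1 + s 1 - 1) := hmin (mk_mem_prod ht hs)
  have hneg : ∀ x y, q (1 - x - 1) (1 - y - 1) = q x y := by
    intro x y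
    simp only [q]
    ring
  rw [h0, h1, hneg, hq, hq, hq] at hle
  have hnn : 0 ≤ q e f := by
    simp only [q]
    nlinarith [sq_nonneg (e - f / 2), sq_nonneg f]
  have hz : q e f = 0 := by
    have h2 : ∀ x : ℝ, 0 ≤ x → x / B ≤ x / 2 := fun x hx => by gcongr
    have a1 := h2 _ hnn
    have a2 := h2 (q e f / B) (by positivity)
    have a3 := h2 (q e f / B / B) (by positivity)
    linarith
  have hf0 : f = 0 := by
    simp only [q] at hz
    have : f ^ 2 = 0 := by nlinarith [sq_nonneg (e - f / 2), sq_nonneg f]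
    simpa using this
  have he0 : e = 0 := by simpa [q, hf0] using hz
  simpa [he0, hf0] using h

end CrysEq

theorem stmt_11 (B : ℤ) (hB : 2 ≤ B)
    (T : Set Pt) (hTne : T.Nonempty) (hTc : IsCompact T) (hT : CrysEq 1 B T) :
    (∀ p q : ℤ, ¬(p = 0 ∧ q = 0) →
      ((T ∩ (fun x : Pt => x + ![(p:ℝ), (q:ℝ)]) '' T).Nonempty ↔
        (p, q) ∈ ({(1,0), (-1,0)} : Set (ℤ × ℤ)))) ∧
    (∀ p q : ℤ,
      ((T ∩ (fun x : Pt => -x + ![(p:ℝ), (q:ℝ)]) '' T).Nonempty ↔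
        (p, q) ∈ ({(0,0), (1,0), (1,1), (0,1)} : Set (ℤ × ℤ)))) := by
  have h11 := hT.isSumOf_one_one hB hTne hTc
  have h01 : IsSumOf T 0 1 := by
    simpa using hT.isSumOf_zero_one_add hB (e := 0) (f := 0) (by simpa using h11)
  have hm10 : IsDiffOf T (-1) 0 := by
    simpa using hT.isDiffOf_neg_one_zero_add hB (e := 0) (f := 0) (by simpa using h01)
  have h10 : IsDiffOf T 1 0 := by simpa using hm10.neg
  have hB' : (0 : ℝ) < B := by exact_mod_cast (by omega : 0 < B)
  have s00 : IsSumOf T 0 0 := by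
    obtain ⟨u, hu, v, hv, h0, h1⟩ := h10
    obtain ⟨t, ht, ht0, ht1⟩ := hT.exists_preimage_add hu (i := B - 2) (by omega) le_rfl
    obtain ⟨s, hs, hs0, hs1⟩ := hT.exists_preimage_neg hv
    push_cast at ht0
    have key : (B : ℝ) * (t 1 + s 1) = 0 := by linarith
    have key' := (mul_eq_zero.1 key).resolve_left hB'.ne'
    exact ⟨t, ht, s, hs, by linarith, key'⟩
  have s10 : IsSumOf T 1 0 := by
    obtain ⟨u, hu, v, hv, h0, h1⟩ := h11
    obtain ⟨t, ht, ht0, ht1⟩ := hT.exists_preimage_add hu (i := B - 2) (by omega) le_rfl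
    obtain ⟨s, hs, hs0, hs1⟩ := hT.exists_preimage_add hv (i := 0) le_rfl (by omega)
    push_cast at ht0 hs0
    have key : (B : ℝ) * (t 1 + s 1) = 0 := by linarith
    have key' := (mul_eq_zero.1 key).resolve_left hB'.ne'
    exact ⟨t, ht, s, hs, by linarith, key'⟩
  refine ⟨fun p q hpq => ?_, fun p q => ?_⟩
  · rw [inter_add_nonempty_iff]
    simp only [mem_insert_iff, mem_singleton_iff, Prod.mk.injEq]
    constructor
    · intro h
      have := hT.mem_of_isDiffOf hB hTc h
      omega
    · rintro (⟨rfl, rfl⟩ | ⟨rfl, rfl⟩)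
      · simpa using h10
      · simpa using hm10
  · rw [inter_neg_add_nonempty_iff]
    simp only [mem_insert_iff, mem_singleton_iff, Prod.mk.injEq]
    constructor
    · intro h
      have := hT.mem_of_isSumOf hB hTc h
      omega
    · rintro (⟨rfl, rfl⟩ | ⟨rfl, rfl⟩ | ⟨rfl, rfl⟩ | ⟨rfl, rfl⟩)
      · simpa using s00
      · simpa using s10
      · simpa using h11
      · simpa using h01
end
end
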